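/- Let G be a finite 2-group whose abelianization G/[G,G] is isomorphic to (ℤ/2) × (ℤ/2). Then G is isomorphic to a dihedral group, a semidihedral group, or a generalized quaternion group. -/

import Mathlib

/-- A group is generalized quaternion if it is isomorphic to `Q_{2^n}` for some `n ≥ 3`;
in Mathlib `Q_{2^n} = QuaternionGroup (2^(n-2))` (of order `4 * 2^(n-2) = 2^n`). -/
def IsGeneralizedQuaternion (Q : Type*) [Group Q] : Prop :=
  ∃ n : ℕ, 3 ≤ n ∧ Nonempty (Q ≃* QuaternionGroup (2 ^ (n - 2)))

/-- The semidihedral group of order `2^n` (for `n ≥ 4`), given by the presentation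
`⟨r, s | r^{2^{n-1}} = s^2 = 1, s r s⁻¹ = r^{2^{n-2} - 1}⟩`, where `r` is the generator
indexed by `true` and `s` the generator indexed by `false`. -/
abbrev SemidihedralGroup (n : ℕ) : Type :=
  PresentedGroup ({FreeGroup.of true ^ (2 ^ (n - 1)), FreeGroup.of false ^ 2,
    FreeGroup.of false * FreeGroup.of true * (FreeGroup.of false)⁻¹ *
      (FreeGroup.of true ^ (2 ^ (n - 2) - 1))⁻¹} : Set (FreeGroup Bool))

/-- A group generated by `r` and `s` in which `s` normalizes `⟨r⟩` and `s ^ 2 ∈ ⟨r⟩` is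
`⟨r⟩ ∪ s⟨r⟩`. -/
theorem eq_zpow_or_eq_mul_zpow_of_closure_eq_top {G : Type*} [Group G] {r s : G}
    (hgen : Subgroup.closure {r, s} = ⊤) {e t : ℤ} (hconj : s * r * s⁻¹ = r ^ e)
    (hsq : s ^ 2 = r ^ t) (g : G) : ∃ i : ℤ, g = r ^ i ∨ g = s * r ^ i := by
  have hconj' (i : ℤ) : r ^ i * s = s * r ^ (e * i) := by
    have h₁ : s * r ^ i * s⁻¹ = r ^ (e * i) := by rw [← conj_zpow, hconj, zpow_mul]
    have h₂ : s ^ 2 * r ^ i = r ^ i * s ^ 2 := by rw [hsq, ← zpow_add, ← zpow_add, add_comm]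
    rw [← h₁]
    calc r ^ i * s = r ^ i * s ^ 2 * s⁻¹ := by rw [sq]; group
      _ = s * (s * r ^ i * s⁻¹) := by rw [← h₂, sq]; group
  have hinv : s⁻¹ = s * r ^ (-t) := by
    rw [zpow_neg, ← hsq]; group
  have hmul (i j : ℤ) : s * r ^ i * (s * r ^ j) = r ^ (t + e * i + j) := by
    rw [mul_assoc, ← mul_assoc (r ^ i), hconj', zpow_add, zpow_add, ← hsq, sq]
    group
  have hmem : g ∈ Subgroup.closure {r, s} := hgen ▸ Subgroup.mem_top g
  induction hmem using Subgroup.closure_induction with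
  | mem x hx =>
    rcases hx with rfl | rfl
    · exact ⟨1, Or.inl (zpow_one _).symm⟩
    · exact ⟨0, Or.inr (by simp)⟩
  | one => exact ⟨0, Or.inl (by simp)⟩
  | mul x y _ _ hx hy =>
    obtain ⟨i, rfl | rfl⟩ := hx <;> obtain ⟨j, rfl | rfl⟩ := hy
    · exact ⟨i + j, Or.inl (zpow_add _ _ _).symm⟩
    · exact ⟨e * i + j, Or.inr (by rw [← mul_assoc, hconj', mul_assoc, zpow_add])⟩
    · exact ⟨i + j, Or.inr (by rw [mul_assoc, zpow_add])⟩
    · exact ⟨t + e * i + j, Or.inl (hmul i j)⟩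
  | inv x _ hx =>
    obtain ⟨i, rfl | rfl⟩ := hx
    · exact ⟨-i, Or.inl (zpow_neg _ _).symm⟩
    · refine ⟨e * (-i) - t, Or.inr ?_⟩
      rw [mul_inv_rev, hinv, ← zpow_neg, ← mul_assoc, hconj', mul_assoc, ← zpow_add, sub_eq_add_neg]

/-- A group `G = ⟨r⟩ ∪ s⟨r⟩` with `s ∉ ⟨r⟩` satisfying the relations `rels` is presented by `rels`,
provided that these relations bound the presented group by `2 * orderOf r`. -/
theorem nonempty_mulEquiv_presentedGroup {G : Type*} [Group G] {r s : G}
    (hs : ∀ i : ℤ, s ≠ r ^ i) (hcover : ∀ g : G, ∃ i : ℤ, g = r ^ i ∨ g = s * r ^ i)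
    {rels : Set (FreeGroup Bool)} (hrels : ∀ w ∈ rels, FreeGroup.lift (fun b ↦ cond b r s) w = 1)
    {e t : ℤ} (hpow : (PresentedGroup.of true : PresentedGroup rels) ^ orderOf r = 1)
    (hconj : (PresentedGroup.of false : PresentedGroup rels) * PresentedGroup.of true *
      (PresentedGroup.of false)⁻¹ = PresentedGroup.of true ^ e)
    (hsq : (PresentedGroup.of false : PresentedGroup rels) ^ 2 = PresentedGroup.of true ^ t) :
    Nonempty (G ≃* PresentedGroup rels) := by
  have hgen : Subgroup.closure {PresentedGroup.of true, PresentedGroup.of false} =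
      (⊤ : Subgroup (PresentedGroup rels)) := by
    rw [← PresentedGroup.closure_range_of rels, Bool.range_eq, Set.pair_comm]
  let φ : PresentedGroup rels →* G := PresentedGroup.toGroup hrels
  have hr : φ (PresentedGroup.of true) = r := PresentedGroup.toGroup.of hrels
  have hs' : φ (PresentedGroup.of false) = s := PresentedGroup.toGroup.of hrels
  refine ⟨(MulEquiv.ofBijective φ ⟨(injective_iff_map_eq_one φ).2 fun x hx ↦ ?_, fun g ↦ ?_⟩).symm⟩
  · obtain ⟨i, rfl | rfl⟩ := eq_zpow_or_eq_mul_zpow_of_closure_eq_top hgen hconj hsq x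
    · rw [map_zpow, hr] at hx
      obtain ⟨j, rfl⟩ := orderOf_dvd_iff_zpow_eq_one.2 hx
      rw [zpow_mul, zpow_natCast, hpow, one_zpow]
    · rw [map_mul, map_zpow, hr, hs', mul_eq_one_iff_eq_inv, ← zpow_neg] at hx
      exact absurd hx (hs _)
  · obtain ⟨i, rfl | rfl⟩ := hcover g
    · exact ⟨PresentedGroup.of true ^ i, by rw [map_zpow, hr]⟩
    · exact ⟨PresentedGroup.of false * PresentedGroup.of true ^ i, by
        rw [map_mul, map_zpow, hr, hs']⟩

/-- The presentation `⟨r, s | r ^ n = 1, s ^ 2 = r ^ t, s r s⁻¹ = r ^ e⟩`, with `r` indexed by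
`true` and `s` by `false`. -/
def cyclicExtensionRels (n : ℕ) (e t : ℤ) : Set (FreeGroup Bool) :=
  {FreeGroup.of true ^ n, FreeGroup.of false ^ 2 * (FreeGroup.of true ^ t)⁻¹,
    FreeGroup.of false * FreeGroup.of true * (FreeGroup.of false)⁻¹ * (FreeGroup.of true ^ e)⁻¹}

theorem nonempty_mulEquiv_cyclicExtension {G : Type*} [Group G] {r s : G}
    (hs : ∀ i : ℤ, s ≠ r ^ i) (hcover : ∀ g : G, ∃ i : ℤ, g = r ^ i ∨ g = s * r ^ i)
    {n : ℕ} {e t : ℤ} (hn : orderOf r = n) (hconj : s * r * s⁻¹ = r ^ e) (hsq : s ^ 2 = r ^ t) :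
    Nonempty (G ≃* PresentedGroup (cyclicExtensionRels n e t)) := by
  have key {w : FreeGroup Bool} (hw : w ∈ cyclicExtensionRels n e t) :
      PresentedGroup.mk (cyclicExtensionRels n e t) w = 1 := PresentedGroup.one_of_mem hw
  refine nonempty_mulEquiv_presentedGroup (e := e) (t := t) hs hcover ?_ ?_ ?_ ?_
  · rintro w (rfl | rfl | rfl)
    · simp [← hn, pow_orderOf_eq_one]
    · simp [hsq]
    · simp [hconj]
  · rw [hn]
    exact key (Or.inl rfl)
  · exact mul_inv_eq_one.1 (key (Or.inr (Or.inr rfl)))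
  · exact mul_inv_eq_one.1 (key (Or.inr (Or.inl rfl)))

theorem nonempty_mulEquiv_dihedralGroup {G : Type*} [Group G] {r s : G}
    (hs : ∀ i : ℤ, s ≠ r ^ i) (hcover : ∀ g : G, ∃ i : ℤ, g = r ^ i ∨ g = s * r ^ i)
    {n : ℕ} (hn : orderOf r = n) (hconj : s * r * s⁻¹ = r⁻¹) (hsq : s ^ 2 = 1) :
    Nonempty (G ≃* DihedralGroup n) := by
  obtain ⟨f⟩ := nonempty_mulEquiv_cyclicExtension (e := -1) (t := 0) hs hcover hn
    (by rw [hconj, zpow_neg_one]) (by rw [hsq, zpow_zero])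
  have hcover' (g : DihedralGroup n) : ∃ i : ℤ, g = .r 1 ^ i ∨ g = .sr 0 * .r 1 ^ i := by
    rcases g with i | i
    · obtain ⟨i, rfl⟩ := ZMod.intCast_surjective i
      exact ⟨i, Or.inl (by simp)⟩
    · obtain ⟨i, rfl⟩ := ZMod.intCast_surjective i
      exact ⟨i, Or.inr (by simp)⟩
  obtain ⟨g⟩ := nonempty_mulEquiv_cyclicExtension (G := DihedralGroup n) (r := .r 1) (s := .sr 0)
    (e := -1) (t := 0) (by simp) hcover' DihedralGroup.orderOf_r_one (by simp) (by simp [sq])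
  exact ⟨f.trans g.symm⟩

theorem QuaternionGroup.a_one_zpow {n : ℕ} (i : ℤ) : (a 1 : QuaternionGroup n) ^ i = a i := by
  cases i with
  | ofNat i => simp
  | negSucc i =>
    rw [zpow_negSucc, inv_eq_iff_mul_eq_one, a_one_pow, a_mul_a, one_def]
    push_cast
    rw [add_neg_cancel]

theorem nonempty_mulEquiv_quaternionGroup {G : Type*} [Group G] {r s : G}
    (hs : ∀ i : ℤ, s ≠ r ^ i) (hcover : ∀ g : G, ∃ i : ℤ, g = r ^ i ∨ g = s * r ^ i)
    {n : ℕ} (hn : orderOf r = 2 * n) (hconj : s * r * s⁻¹ = r⁻¹) (hsq : s ^ 2 = r ^ n) :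
    Nonempty (G ≃* QuaternionGroup n) := by
  obtain ⟨f⟩ := nonempty_mulEquiv_cyclicExtension (e := -1) (t := n) hs hcover hn
    (by rw [hconj, zpow_neg_one]) (by rw [hsq, zpow_natCast])
  have hcover' (g : QuaternionGroup n) : ∃ i : ℤ, g = .a 1 ^ i ∨ g = .xa 0 * .a 1 ^ i := by
    rcases g with i | i
    · obtain ⟨i, rfl⟩ := ZMod.intCast_surjective i
      exact ⟨i, Or.inl (by simp [QuaternionGroup.a_one_zpow])⟩
    · obtain ⟨i, rfl⟩ := ZMod.intCast_surjective i
      exact ⟨i, Or.inr (by simp [QuaternionGroup.a_one_zpow])⟩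
  obtain ⟨g⟩ := nonempty_mulEquiv_cyclicExtension (G := QuaternionGroup n) (r := .a 1) (s := .xa 0)
    (e := -1) (t := n) (by simp [QuaternionGroup.a_one_zpow]) hcover'
    QuaternionGroup.orderOf_a_one
    (by simp [mul_inv_eq_iff_eq_mul, QuaternionGroup.a_one_zpow, -zpow_neg])
    (by simp)
  exact ⟨f.trans g.symm⟩

theorem nonempty_mulEquiv_semidihedralGroup {G : Type*} [Group G] {r s : G}
    (hs : ∀ i : ℤ, s ≠ r ^ i) (hcover : ∀ g : G, ∃ i : ℤ, g = r ^ i ∨ g = s * r ^ i)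
    {n : ℕ} (hn : orderOf r = 2 ^ (n - 1)) (hconj : s * r * s⁻¹ = r ^ (2 ^ (n - 2) - 1))
    (hsq : s ^ 2 = 1) : Nonempty (G ≃* SemidihedralGroup n) := by
  refine nonempty_mulEquiv_presentedGroup (e := (2 ^ (n - 2) - 1 : ℕ)) (t := 0)
    hs hcover ?_ ?_ ?_ ?_
  · rintro w (rfl | rfl | rfl)
    · simp [← hn, pow_orderOf_eq_one]
    · simp [hsq]
    · simp [hconj]
  · rw [hn]
    exact PresentedGroup.one_of_mem (Or.inl rfl)
  · rw [zpow_natCast]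
    exact mul_inv_eq_one.1 (PresentedGroup.one_of_mem (Or.inr (Or.inr rfl)))
  · rw [zpow_zero]
    exact PresentedGroup.one_of_mem (Or.inr (Or.inl rfl))

/-- `G = ⟨r⟩ ∪ s⟨r⟩` where `r` has order `2 ^ k ≥ 4` and `s` acts on `⟨r⟩` as an exponent
congruent to `-1` modulo `4`. -/
structure IsTwistedCyclicExtension {G : Type*} [Group G] (r s : G) (k : ℕ) (e : ℤ) : Prop where
  two_le : 2 ≤ k
  orderOf_eq : orderOf r = 2 ^ k
  emod_four : e % 4 = 3
  conj_eq : s * r * s⁻¹ = r ^ e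
  cover : ∀ g : G, ∃ i : ℤ, g = r ^ i ∨ g = s * r ^ i

namespace IsTwistedCyclicExtension

variable {G : Type*} [Group G] {r s : G} {k : ℕ} {e : ℤ}

theorem zpow_eq_one_iff (h : IsTwistedCyclicExtension r s k e) (i : ℤ) :
    r ^ i = 1 ↔ (2 : ℤ) ^ k ∣ i := by
  rw [← orderOf_dvd_iff_zpow_eq_one, h.orderOf_eq]
  norm_cast

theorem four_dvd (h : IsTwistedCyclicExtension r s k e) : (4 : ℤ) ∣ 2 ^ k :=
  pow_dvd_pow (2 : ℤ) h.two_le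

theorem ne_zpow (h : IsTwistedCyclicExtension r s k e) (i : ℤ) : s ≠ r ^ i := by
  rintro rfl
  have h₁ : r ^ (e - 1) = 1 := by
    rw [zpow_sub_one, ← h.conj_eq]
    group
  have := h.four_dvd.trans ((h.zpow_eq_one_iff _).1 h₁)
  have := h.emod_four
  omega

/-- Since `(e - 1) / 2` is odd, it is invertible modulo powers of two. -/
theorem two_pow_dvd_of_mul_sub_one (h : IsTwistedCyclicExtension r s k e) {m : ℕ} {x : ℤ}
    (hx : (2 : ℤ) ^ (m + 1) ∣ x * (e - 1)) : (2 : ℤ) ^ m ∣ x := by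
  have he := h.emod_four
  obtain ⟨f, hf⟩ : ∃ f, e - 1 = 2 * (2 * f + 1) := ⟨(e - 3) / 4, by omega⟩
  rw [hf, pow_succ', mul_left_comm] at hx
  refine IsCoprime.dvd_of_dvd_mul_right (IsCoprime.pow_left ?_)
    (Int.dvd_of_mul_dvd_mul_left two_ne_zero hx)
  exact ⟨-f, 1, by ring⟩

theorem classification (h : IsTwistedCyclicExtension r s k e) :
    (∃ m : ℕ, Nonempty (G ≃* DihedralGroup (2 ^ m))) ∨
    (∃ n : ℕ, 4 ≤ n ∧ Nonempty (G ≃* SemidihedralGroup n)) ∨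
    IsGeneralizedQuaternion G := by
  have hs := h.ne_zpow
  obtain ⟨m, rfl⟩ : ∃ m, k = m + 1 := ⟨k - 1, by have := h.two_le; omega⟩
  have hm : 1 ≤ m := by have := h.two_le; omega
  have hconj (i : ℤ) : s * r ^ i * s⁻¹ = r ^ (e * i) := by
    rw [← conj_zpow, h.conj_eq, zpow_mul]
  obtain ⟨t, ht⟩ : ∃ t : ℤ, s ^ 2 = r ^ t := by
    obtain ⟨t, ht | ht⟩ := h.cover (s ^ 2)
    · exact ⟨t, ht⟩
    · exact absurd (mul_left_cancel ((sq s).symm.trans ht)) (hs t)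
  have hzpow {i j : ℤ} (hij : (2 : ℤ) ^ (m + 1) ∣ i - j) : r ^ i = r ^ j := by
    rwa [← mul_inv_eq_one, ← zpow_sub, h.zpow_eq_one_iff]
  have hdvd {i j : ℤ} (hij : r ^ i = r ^ j) : (2 : ℤ) ^ (m + 1) ∣ i - j := by
    rwa [← h.zpow_eq_one_iff, zpow_sub, mul_inv_eq_one]
  obtain ⟨q, hq⟩ : (2 : ℤ) ^ m ∣ e + 1 := by
    apply h.two_pow_dvd_of_mul_sub_one
    have h₁ : r ^ (e * e) = r ^ (1 : ℤ) := by
      calc r ^ (e * e) = s * (s * r * s⁻¹) * s⁻¹ := by rw [h.conj_eq, hconj]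
        _ = s ^ 2 * r * (s ^ 2)⁻¹ := by rw [sq]; group
        _ = r ^ (1 : ℤ) := by rw [ht]; group
    convert hdvd h₁ using 1
    ring
  obtain ⟨u, hu⟩ : (2 : ℤ) ^ m ∣ t := by
    apply h.two_pow_dvd_of_mul_sub_one
    have h₁ : r ^ (e * t) = r ^ t := by
      rw [← hconj, ← ht, sq]
      group
    convert hdvd h₁ using 1
    ring
  have hord : orderOf r = 2 * 2 ^ m := by rw [h.orderOf_eq, pow_succ']
  obtain ⟨q, rfl | rfl⟩ := Int.even_or_odd' q
  · have hinv : s * r * s⁻¹ = r⁻¹ := by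
      rw [h.conj_eq, ← zpow_neg_one]
      exact hzpow ⟨q, by rw [sub_neg_eq_add, hq]; ring⟩
    obtain ⟨u, rfl | rfl⟩ := Int.even_or_odd' u
    · refine Or.inl ⟨m + 1, nonempty_mulEquiv_dihedralGroup hs h.cover h.orderOf_eq hinv ?_⟩
      rw [ht, ← zpow_zero r]
      exact hzpow ⟨u, by rw [hu]; ring⟩
    · refine Or.inr (Or.inr ⟨m + 2, by omega,
        nonempty_mulEquiv_quaternionGroup hs h.cover hord hinv ?_⟩)
      rw [ht, ← zpow_natCast]
      exact hzpow ⟨u, by rw [hu]; push_cast; ring⟩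
  · have hm2 : 2 ≤ m := by
      by_contra! hlt
      obtain rfl : m = 1 := by omega
      have := h.emod_four
      omega
    have hpow : s * r * s⁻¹ = r ^ (2 ^ m - 1) := by
      rw [h.conj_eq, ← zpow_natCast, Nat.cast_sub Nat.one_le_two_pow]
      refine hzpow ⟨q, ?_⟩
      rw [eq_sub_of_add_eq hq]
      push_cast
      ring
    refine Or.inr (Or.inl ⟨m + 2, by omega, ?_⟩)
    obtain ⟨u, rfl | rfl⟩ := Int.even_or_odd' u
    · refine nonempty_mulEquiv_semidihedralGroup hs h.cover h.orderOf_eq hpow ?_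
      rw [ht, ← zpow_zero r]
      exact hzpow ⟨u, by rw [hu]; ring⟩
    · refine nonempty_mulEquiv_semidihedralGroup (r := r) (s := s * r) (fun i hi ↦ ?_) (fun g ↦ ?_)
        h.orderOf_eq ?_ ?_
      · exact hs (i - 1) (by rw [zpow_sub_one, ← hi, mul_inv_cancel_right])
      · obtain ⟨i, hi | hi⟩ := h.cover g
        · exact ⟨i, Or.inl hi⟩
        · exact ⟨i - 1, Or.inr (by rw [hi]; group)⟩
      · rw [← mul_inv_cancel_right s r] at hpow
        simpa [mul_assoc] using hpow
      · calc (s * r) ^ 2 = s * r * s⁻¹ * s ^ 2 * r := by rw [sq, sq]; group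
          _ = r ^ (e + t + 1) := by rw [h.conj_eq, ht, ← zpow_add, ← zpow_add_one]
          _ = r ^ (0 : ℤ) := hzpow ⟨q + u + 1, by
            rw [show e + t + 1 - 0 = (e + 1) + t by ring, hq, hu]; ring⟩
          _ = 1 := zpow_zero r

end IsTwistedCyclicExtension

theorem IsPGroup.exists_mem_center_orderOf_eq {G : Type*} [Group G] [Finite G] {p : ℕ}
    [Fact p.Prime] (hG : IsPGroup p G) {N : Subgroup G} [N.Normal] (hN : N ≠ ⊥) :
    ∃ z ∈ N, z ∈ Subgroup.center G ∧ orderOf z = p := by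
  have hdvd : p ∣ Nat.card N := by
    have := (Subgroup.nontrivial_iff_ne_bot N).2 hN
    obtain ⟨n, hn0, hn⟩ := (hG.to_subgroup N).nontrivial_iff_card.mp inferInstance
    exact hn.symm ▸ dvd_pow_self _ (ne_of_gt hn0)
  obtain ⟨b, hb, hb1⟩ :=
    (hG.of_equiv ConjAct.toConjAct).exists_fixed_point_of_prime_dvd_card_of_fixed_point N hdvd
      (a := 1) (fun g ↦ smul_one g)
  have hbc : (b : G) ∈ N ⊓ Subgroup.center G := by
    refine ⟨b.2, Subgroup.mem_center_iff.2 fun g ↦ ?_⟩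
    have h := congrArg Subtype.val (hb (ConjAct.toConjAct g))
    rw [ConjAct.Subgroup.val_conj_smul, ConjAct.toConjAct_smul] at h
    exact mul_inv_eq_iff_eq_mul.1 h
  have hdvd' : p ∣ Nat.card (N ⊓ Subgroup.center G : Subgroup G) := by
    have : Nontrivial (N ⊓ Subgroup.center G : Subgroup G) :=
      ⟨⟨⟨b, hbc⟩, 1, fun h ↦ hb1 (Subtype.ext (congrArg Subtype.val h).symm)⟩⟩
    obtain ⟨n, hn0, hn⟩ := (hG.to_subgroup (N ⊓ Subgroup.center G)).nontrivial_iff_card.mp this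
    exact hn.symm ▸ dvd_pow_self _ (ne_of_gt hn0)
  obtain ⟨z, hz⟩ := exists_prime_orderOf_dvd_card' p hdvd'
  exact ⟨z, z.2.1, z.2.2, by rw [Subgroup.orderOf_coe, hz]⟩

/-- The abelianization of `G` is generated by the images of `a` and `b`, which square to `1`. -/
structure GeneratesAbelianization {G : Type*} [Group G] (a b : G) : Prop where
  sq_left : a ^ 2 ∈ commutator G
  sq_right : b ^ 2 ∈ commutator G
  cover : ∀ g : G, ∃ c ∈ commutator G, ∃ i j : ℕ, g = a ^ i * b ^ j * c

theorem map_mem_commutator {G H : Type*} [Group G] [Group H] (f : G →* H) {x : G}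
    (hx : x ∈ commutator G) : f x ∈ commutator H := by
  have h := Subgroup.mem_map_of_mem f hx
  rw [commutator_def, Subgroup.map_commutator] at h
  exact Subgroup.commutator_mono le_top le_top h

theorem GeneratesAbelianization.map {G H : Type*} [Group G] [Group H] {a b : G}
    (h : GeneratesAbelianization a b) (f : G →* H) (hf : Function.Surjective f) :
    GeneratesAbelianization (f a) (f b) where
  sq_left := map_pow f a 2 ▸ map_mem_commutator f h.sq_left
  sq_right := map_pow f b 2 ▸ map_mem_commutator f h.sq_right
  cover g := by
    obtain ⟨g, rfl⟩ := hf g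
    obtain ⟨c, hc, i, j, rfl⟩ := h.cover g
    exact ⟨f c, map_mem_commutator f hc, i, j, by simp⟩

theorem exists_generatesAbelianization {G : Type*} [Group G]
    (f : Abelianization G ≃* Multiplicative (ZMod 2 × ZMod 2)) :
    ∃ a b : G, GeneratesAbelianization a b := by
  have hsurj : Function.Surjective (Abelianization.of : G →* Abelianization G) :=
    QuotientGroup.mk_surjective
  have hmem (g : G) (hg : f (Abelianization.of g) = 1) : g ∈ commutator G := by
    rw [← Abelianization.ker_of, MonoidHom.mem_ker]
    exact (map_eq_one_iff f f.injective).1 hg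
  obtain ⟨a, ha⟩ := hsurj (f.symm (.ofAdd (1, 0)))
  obtain ⟨b, hb⟩ := hsurj (f.symm (.ofAdd (0, 1)))
  refine ⟨a, b, hmem _ ?_, hmem _ ?_, fun g ↦ ?_⟩
  · rw [map_pow, ha, map_pow, f.apply_symm_apply]
    decide
  · rw [map_pow, hb, map_pow, f.apply_symm_apply]
    decide
  · have key : ∀ x : Multiplicative (ZMod 2 × ZMod 2), ∃ i < 2, ∃ j < 2,
        (Multiplicative.ofAdd (((1 : ZMod 2), (0 : ZMod 2))) ^ i *
          Multiplicative.ofAdd (((0 : ZMod 2), (1 : ZMod 2))) ^ j) = x := by decide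
    obtain ⟨i, -, j, -, hij⟩ := key (f (Abelianization.of g))
    refine ⟨(a ^ i * b ^ j)⁻¹ * g, hmem _ ?_, i, j, by group⟩
    simp only [map_mul, map_inv, map_pow, ha, hb, f.apply_symm_apply, ← hij]
    group

theorem mem_zpowers_of_orderOf_eq_two {G : Type*} [Group G] {z u : G} (hz : orderOf z = 2)
    (hu : u ∈ Subgroup.zpowers z) : u = 1 ∨ u = z := by
  obtain ⟨i, rfl⟩ := Subgroup.mem_zpowers_iff.1 hu
  have hz2 : z ^ 2 = 1 := hz ▸ pow_orderOf_eq_one z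
  obtain ⟨j, rfl | rfl⟩ := Int.even_or_odd' i
  · left; rw [zpow_mul, zpow_ofNat, hz2, one_zpow]
  · right; rw [zpow_add_one, zpow_mul, zpow_ofNat, hz2, one_zpow, one_mul]

theorem GeneratesAbelianization.exists_isTwistedCyclicExtension_of_le {G : Type*} [Group G]
    {a b z : G} (h : GeneratesAbelianization a b) (hz : orderOf z = 2)
    (hzc : z ∈ Subgroup.center G) (hle : commutator G ≤ Subgroup.zpowers z)
    (hne : commutator G ≠ ⊥) :
    ∃ r s : G, IsTwistedCyclicExtension r s 2 3 := by
  have hz2 : z ^ 2 = 1 := hz ▸ pow_orderOf_eq_one z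
  have hcomm (g : G) : Commute z g := (Subgroup.mem_center_iff.1 hzc g).symm
  have hz1 : z ≠ 1 := by rintro rfl; simp at hz
  -- It suffices to find generators `x` and `y` with `x ^ 2 = z` that do not commute.
  have main {x y : G} (hx : x ^ 2 = z) (hxy : ¬ Commute y x) (hy : y ^ 2 = 1 ∨ y ^ 2 = z)
      (ha : a ∈ Subgroup.closure {x, y}) (hb : b ∈ Subgroup.closure {x, y}) :
      ∃ r s : G, IsTwistedCyclicExtension r s 2 3 := by
    have hconj : y * x * y⁻¹ = x ^ (3 : ℤ) := by
      have h₁ : y * x * y⁻¹ * x⁻¹ = z :=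
        (mem_zpowers_of_orderOf_eq_two hz (hle (Subgroup.commutator_mem_commutator
          (Subgroup.mem_top y) (Subgroup.mem_top x)))).resolve_left
          fun h ↦ hxy (commutatorElement_eq_one_iff_commute.1 h)
      rw [mul_inv_eq_iff_eq_mul.1 h₁, ← hx]
      group
    have hord : orderOf x = 2 ^ 2 := by
      refine orderOf_eq_prime_pow ?_ ?_
      · rw [pow_one, hx]
        exact hz1
      · rw [pow_succ, pow_one, pow_mul, hx, hz2]
    obtain ⟨t, ht⟩ : ∃ t : ℤ, y ^ 2 = x ^ t := by
      rcases hy with hy | hy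
      · exact ⟨0, by rw [hy, zpow_zero]⟩
      · exact ⟨2, by rw [hy, ← hx, zpow_ofNat]⟩
    have hgen : Subgroup.closure {x, y} = ⊤ := by
      refine eq_top_iff.2 fun g _ ↦ ?_
      obtain ⟨c, hc, i, j, rfl⟩ := h.cover g
      refine mul_mem (mul_mem (pow_mem ha i) (pow_mem hb j)) ?_
      refine (Subgroup.zpowers_le.2 ?_) (hle hc)
      rw [← hx]
      exact pow_mem (Subgroup.subset_closure (Set.mem_insert x {y})) 2
    exact ⟨x, y, le_rfl, hord, by norm_num, hconj,
      eq_zpow_or_eq_mul_zpow_of_closure_eq_top hgen hconj ht⟩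
  have hab : ¬ Commute a b := by
    intro hab
    refine hne ((Subgroup.commutator_eq_bot_iff_le_centralizer).2 fun g _ ↦ ?_)
    rw [Subgroup.mem_centralizer_iff]
    rintro g₁ -
    have key (g : G) : ∃ i j : ℕ, ∃ l : ℤ, g = a ^ i * b ^ j * z ^ l := by
      obtain ⟨c, hc, i, j, rfl⟩ := h.cover g
      obtain ⟨l, rfl⟩ := Subgroup.mem_zpowers_iff.1 (hle hc)
      exact ⟨i, j, l, rfl⟩
    obtain ⟨i, j, l, rfl⟩ := key g
    obtain ⟨i₁, j₁, l₁, rfl⟩ := key g₁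
    have hz' (l : ℤ) (g : G) : Commute (z ^ l) g := (hcomm g).zpow_left l
    have h₁ : Commute (a ^ i₁ * b ^ j₁) (a ^ i * b ^ j) :=
      .mul_left (.mul_right (Commute.pow_pow_self a _ _) (hab.pow_pow _ _))
        (.mul_right (hab.symm.pow_pow _ _) (Commute.pow_pow_self b _ _))
    exact Commute.mul_left (h₁.mul_right (hz' _ _).symm) (hz' _ _)
  have hsq {x : G} (hx : x ^ 2 ∈ commutator G) : x ^ 2 = 1 ∨ x ^ 2 = z :=
    mem_zpowers_of_orderOf_eq_two hz (hle hx)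
  have hleft (x y : G) : x ∈ Subgroup.closure {x, y} :=
    Subgroup.subset_closure (Set.mem_insert x {y})
  have hright (x y : G) : y ∈ Subgroup.closure {x, y} :=
    Subgroup.subset_closure (Set.mem_insert_of_mem x rfl)
  rcases hsq h.sq_left with ha | ha
  · rcases hsq h.sq_right with hb | hb
    · have hab' : ¬ Commute b (a * b) := fun h ↦ hab <| by
        have := h.mul_right (Commute.refl b).inv_right
        rw [mul_inv_cancel_right] at this
        exact this.symm
      refine main (x := a * b) (y := b) ?_ hab' (Or.inl hb) ?_ (hright _ _)
      · refine (mem_zpowers_of_orderOf_eq_two hz (hle ?_)).resolve_left fun h1 ↦ hab ?_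
        · have : (a * b) ^ 2 = a * b * a⁻¹ * b⁻¹ := by
            rw [inv_eq_of_mul_eq_one_left ((sq a).symm.trans ha),
              inv_eq_of_mul_eq_one_left ((sq b).symm.trans hb), sq, mul_assoc (a * b)]
          rw [this]
          exact Subgroup.commutator_mem_commutator (Subgroup.mem_top a) (Subgroup.mem_top b)
        · have := eq_inv_of_mul_eq_one_left ((sq _).symm.trans h1)
          rwa [mul_inv_rev, inv_eq_of_mul_eq_one_left ((sq a).symm.trans ha),
              inv_eq_of_mul_eq_one_left ((sq b).symm.trans hb)] at this
      · have := mul_mem (hleft (a * b) b) (inv_mem (hright (a * b) b))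
        rwa [mul_inv_cancel_right] at this
    · exact main hb hab (Or.inl ha) (hright _ _) (hleft _ _)
  · exact main ha (fun h ↦ hab h.symm) (hsq h.sq_right) (hleft _ _) (hright _ _)

theorem IsTwistedCyclicExtension.of_map {G H : Type*} [Group G] [Group H] {π : G →* H} {z : G}
    (hz : orderOf z = 2) (hzc : z ∈ Subgroup.center G) (hker : π.ker = Subgroup.zpowers z)
    (hzG : z ∈ commutator G) {r s : G} {k : ℕ} {e : ℤ}
    (h : IsTwistedCyclicExtension (π r) (π s) k e) :
    ∃ e₁, IsTwistedCyclicExtension r s (k + 1) e₁ := by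
  have hz2 : z ^ 2 = 1 := hz ▸ pow_orderOf_eq_one z
  have hz1 : z ≠ 1 := by rintro rfl; simp at hz
  have hfiber {x y : G} (hxy : π x = π y) :
      ∃ u ∈ Subgroup.center G, (u = 1 ∨ u = z) ∧ x = y * u := by
    have hu : y⁻¹ * x = 1 ∨ y⁻¹ * x = z := mem_zpowers_of_orderOf_eq_two hz <| by
      rw [← hker, MonoidHom.mem_ker, map_mul, map_inv, hxy, inv_mul_cancel]
    refine ⟨y⁻¹ * x, ?_, hu, by group⟩
    rcases hu with hu | hu
    · exact hu ▸ one_mem _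
    · exact hu ▸ hzc
  have hcover (g : G) : ∃ i : ℤ, ∃ u ∈ Subgroup.center G, (u = 1 ∨ u = z) ∧
      (g = r ^ i * u ∨ g = s * r ^ i * u) := by
    obtain ⟨i, hi | hi⟩ := h.cover (π g)
    · obtain ⟨u, huc, hu, hg⟩ := hfiber (hi.trans (map_zpow π r i).symm)
      exact ⟨i, u, huc, hu, Or.inl hg⟩
    · obtain ⟨u, huc, hu, hg⟩ := hfiber (x := g) (y := s * r ^ i) (by rw [hi, map_mul, map_zpow])
      exact ⟨i, u, huc, hu, Or.inr hg⟩
  obtain ⟨u, huc, hu, hconj⟩ := hfiber (x := s * r * s⁻¹) (y := r ^ e)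
    (by rw [map_mul, map_mul, map_inv, h.conj_eq, map_zpow])
  have hrpow : r ^ 2 ^ k = 1 ∨ r ^ 2 ^ k = z := by
    obtain ⟨v, -, hv, hr⟩ := hfiber (x := r ^ 2 ^ k) (y := 1)
      (by rw [map_pow, ← h.orderOf_eq, pow_orderOf_eq_one, map_one])
    rwa [hr, one_mul]
  have hrz : r ^ 2 ^ k = z := by
    refine hrpow.resolve_left fun hr ↦ hz1 ?_
    have hcent {v : G} (hv : v ∈ Subgroup.center G) (g : G) : Commute v g :=
      (Subgroup.mem_center_iff.1 hv g).symm
    have hu2 : u ^ 2 = 1 := by rcases hu with rfl | rfl <;> simp [hz2]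
    -- The commutator subgroup is generated by the commutator of `s` and `r`.
    set c := r ^ (e - 1) * u with hc
    have hcpow (m : ℤ) : c ^ m = r ^ ((e - 1) * m) * u ^ m := by
      rw [hc, (hcent huc _).symm.mul_zpow, zpow_mul]
    have hcr : s * r * s⁻¹ * r⁻¹ = c := by
      rw [hconj, mul_assoc, (hcent huc r⁻¹).eq, ← mul_assoc, ← zpow_sub_one]
    have hcs : s * c * s⁻¹ = c ^ e := by
      calc s * c * s⁻¹ = (s * r * s⁻¹) ^ (e - 1) * u := by
            rw [hc, conj_zpow, mul_assoc, mul_assoc, (hcent huc _).eq]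
            group
        _ = c ^ e := by
            rw [hconj, (hcent huc _).symm.mul_zpow, ← zpow_mul, hcpow, mul_assoc, ← zpow_add_one,
              sub_add_cancel, mul_comm e]
    have hcomm_r (i m : ℤ) : Commute (r ^ i) (c ^ m) := by
      refine Commute.zpow_zpow ?_ i m
      exact ((Commute.refl r).zpow_right _).mul_right (hcent huc r).symm
    have hnormal : (Subgroup.zpowers c).Normal := by
      refine ⟨fun n hn g ↦ ?_⟩
      obtain ⟨m, rfl⟩ := Subgroup.mem_zpowers_iff.1 hn
      obtain ⟨i, v, hv, -, rfl | rfl⟩ := hcover g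
      · rw [((hcomm_r i m).mul_left (hcent hv _)).eq, mul_inv_cancel_right]
        exact hn
      · rw [mul_assoc s, mul_assoc s, ((hcomm_r i m).mul_left (hcent hv _)).eq, mul_inv_rev,
          ← mul_assoc, mul_assoc s, mul_inv_cancel_right, ← conj_zpow, hcs]
        exact zpow_mem (zpow_mem (Subgroup.mem_zpowers c) e) m
    have hle : commutator G ≤ Subgroup.zpowers c := by
      let q := QuotientGroup.mk' (Subgroup.zpowers c)
      have hrs : Commute (q s) (q r) := by
        have h₁ : q (s * r * s⁻¹ * r⁻¹) = 1 := by
          rw [hcr]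
          exact (QuotientGroup.eq_one_iff c).2 (Subgroup.mem_zpowers c)
        rw [map_mul, map_mul, map_mul, map_inv, map_inv] at h₁
        exact commutatorElement_eq_one_iff_commute.1 h₁
      have hqcent {v : G} (hv : v ∈ Subgroup.center G) (x : G ⧸ Subgroup.zpowers c) :
          Commute (q v) x := by
        obtain ⟨g, rfl⟩ := QuotientGroup.mk'_surjective _ x
        exact (hcent hv g).map q
      have hqr (g : G) : Commute (q r) (q g) := by
        obtain ⟨i, v, hv, -, rfl | rfl⟩ := hcover g
        · rw [map_mul, map_zpow]
          exact ((Commute.refl _).zpow_right i).mul_right (hqcent hv _).symm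
        · rw [map_mul, map_mul, map_zpow]
          exact (hrs.symm.mul_right ((Commute.refl _).zpow_right i)).mul_right (hqcent hv _).symm
      have hqs (g : G) : Commute (q s) (q g) := by
        obtain ⟨i, v, hv, -, rfl | rfl⟩ := hcover g
        · rw [map_mul, map_zpow]
          exact (hrs.zpow_right i).mul_right (hqcent hv _).symm
        · rw [map_mul, map_mul, map_zpow]
          exact ((Commute.refl _).mul_right (hrs.zpow_right i)).mul_right (hqcent hv _).symm
      rw [commutator_def, Subgroup.commutator_le]
      rintro g - g₁ -
      rw [← QuotientGroup.eq_one_iff]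
      refine (map_commutatorElement q g g₁).trans (commutatorElement_eq_one_iff_commute.2 ?_)
      obtain ⟨i, v, hv, -, rfl | rfl⟩ := hcover g
      · rw [map_mul, map_zpow]
        exact ((hqr g₁).zpow_left i).mul_left (hqcent hv _)
      · rw [map_mul, map_mul, map_zpow]
        exact ((hqs g₁).mul_left ((hqr g₁).zpow_left i)).mul_left (hqcent hv _)
    obtain ⟨m, hm⟩ := Subgroup.mem_zpowers_iff.1 (hle hzG)
    have hπz : π z = 1 := by
      rw [← MonoidHom.mem_ker, hker]
      exact Subgroup.mem_zpowers z
    have hπu : π u = 1 := by rcases hu with rfl | rfl <;> simp [hπz]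
    have hdvd : (2 : ℤ) ^ k ∣ m * (e - 1) := by
      rw [← h.zpow_eq_one_iff, ← hπz, ← hm, hcpow, map_mul, map_zpow, map_zpow, hπu, one_zpow,
        mul_one, mul_comm m]
    obtain ⟨l, rfl⟩ : ∃ l, k = l + 1 + 1 := ⟨k - 2, by have := h.two_le; omega⟩
    obtain ⟨m₁, hm'⟩ : (2 : ℤ) ∣ m :=
      (dvd_pow_self 2 l.succ_ne_zero).trans (h.two_pow_dvd_of_mul_sub_one hdvd)
    obtain ⟨d, hd⟩ := hdvd
    rw [← hm, hcpow, mul_comm (e - 1), hd, zpow_mul, hm', zpow_mul u, zpow_ofNat, hu2, one_zpow,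
      mul_one]
    have : r ^ ((2 : ℤ) ^ (l + 1 + 1)) = 1 := by exact_mod_cast hr
    rw [this, one_zpow]
  have hcover' (g : G) : ∃ i : ℤ, g = r ^ i ∨ g = s * r ^ i := by
    have hv' {v : G} (hv : v = 1 ∨ v = z) : ∃ j : ℤ, v = r ^ j := by
      rcases hv with rfl | rfl
      · exact ⟨0, (zpow_zero r).symm⟩
      · exact ⟨(2 ^ k : ℕ), by rw [zpow_natCast, hrz]⟩
    obtain ⟨i, v, -, hv, hg⟩ := hcover g
    obtain ⟨j, rfl⟩ := hv' hv
    exact ⟨i + j, by rwa [zpow_add, ← mul_assoc]⟩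
  have hord : orderOf r = 2 ^ (k + 1) := by
    refine orderOf_eq_prime_pow (hrz ▸ hz1) ?_
    rw [pow_succ, pow_mul, hrz, hz2]
  have hk : 2 ≤ k + 1 := h.two_le.trans k.le_succ
  rcases hu with rfl | rfl
  · exact ⟨e, hk, hord, h.emod_four, by rw [hconj, mul_one], hcover'⟩
  · refine ⟨e + (2 ^ k : ℕ), hk, hord, ?_, by rw [hconj, zpow_add, zpow_natCast, hrz], hcover'⟩
    have h4 := h.four_dvd
    have he := h.emod_four
    push_cast
    omega

theorem GeneratesAbelianization.exists_isTwistedCyclicExtension {G : Type*} [Group G] [Finite G]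
    (h2 : IsPGroup 2 G) {a b : G} (h : GeneratesAbelianization a b) (hne : commutator G ≠ ⊥) :
    ∃ (r s : G) (k : ℕ) (e : ℤ), IsTwistedCyclicExtension r s k e := by
  induction hn : Nat.card G using Nat.strong_induction_on generalizing G with
  | _ n ih =>
    obtain ⟨z, hzG, hzc, hz⟩ := h2.exists_mem_center_orderOf_eq hne
    have hle : Subgroup.zpowers z ≤ Subgroup.center G := Subgroup.zpowers_le.2 hzc
    have hnormal : (Subgroup.zpowers z).Normal := ⟨fun x hx g ↦ by
      rwa [Subgroup.mem_center_iff.1 (hle hx) g, mul_inv_cancel_right]⟩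
    let π := QuotientGroup.mk' (Subgroup.zpowers z)
    have hπ : Function.Surjective π := QuotientGroup.mk'_surjective _
    have hker : π.ker = Subgroup.zpowers z := QuotientGroup.ker_mk' _
    by_cases hcomm : commutator (G ⧸ Subgroup.zpowers z) = ⊥
    · have hle' : commutator G ≤ Subgroup.zpowers z := by
        intro x hx
        rw [← hker, MonoidHom.mem_ker, ← Subgroup.mem_bot, ← hcomm]
        exact map_mem_commutator π hx
      obtain ⟨r, s, hrs⟩ := h.exists_isTwistedCyclicExtension_of_le hz hzc hle' hne
      exact ⟨r, s, 2, 3, hrs⟩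
    · have hcard : Nat.card (G ⧸ Subgroup.zpowers z) < n := by
        have := Subgroup.card_eq_card_quotient_mul_card_subgroup (Subgroup.zpowers z)
        rw [Nat.card_zpowers, hz, hn] at this
        have : 0 < n := hn ▸ Nat.card_pos
        omega
      obtain ⟨r, s, k, e, hrs⟩ := ih _ hcard (h2.to_quotient _) (h.map π hπ) hcomm rfl
      obtain ⟨r, rfl⟩ := hπ r
      obtain ⟨s, rfl⟩ := hπ s
      obtain ⟨e₁, he'⟩ := hrs.of_map hz hzc hker hzG
      exact ⟨r, s, k + 1, e₁, he'⟩

/-- Taussky: A finite 2-group whose abelianization is `(ℤ/2) × (ℤ/2)` is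
dihedral, semidihedral, or generalized quaternion. -/
theorem stmt_5 (G : Type*) [Group G] [Finite G] (h2 : IsPGroup 2 G)
    (hab : Nonempty (Abelianization G ≃* Multiplicative (ZMod 2 × ZMod 2))) :
    (∃ m : ℕ, Nonempty (G ≃* DihedralGroup (2 ^ m))) ∨
    (∃ n : ℕ, 4 ≤ n ∧ Nonempty (G ≃* SemidihedralGroup n)) ∨
    IsGeneralizedQuaternion G := by
  obtain ⟨f⟩ := hab
  by_cases hcomm : commutator G = ⊥
  · obtain ⟨g⟩ := IsKleinFour.nonempty_mulEquiv (G₁ := Multiplicative (ZMod 2 × ZMod 2))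
      (G₂ := DihedralGroup 2)
    have hbij : Function.Bijective (Abelianization.of : G →* Abelianization G) := by
      refine ⟨?_, QuotientGroup.mk_surjective⟩
      rw [← MonoidHom.ker_eq_bot_iff, Abelianization.ker_of, hcomm]
    exact Or.inl ⟨1, ⟨((MulEquiv.ofBijective _ hbij).trans f).trans g⟩⟩
  · obtain ⟨a, b, h⟩ := exists_generatesAbelianization f
    obtain ⟨r, s, k, e, hrs⟩ := h.exists_isTwistedCyclicExtension h2 hcomm
    exact hrs.classification
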